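/- Let σ and w be locally finite positive Borel measures on ℝ with no common point masses, assigning no mass to the endpoints of intervals of the standard dyadic grid 𝒟, satisfying the Poisson A₂ condition with constant 𝒜₂ and the interval testing conditions with constant 𝒯; set 𝓗 = 𝒜₂^{1/2} + 𝒯. Then for every interval I₀ and every partition 𝒫 of I₀ into intervals of 𝒟: Σ_{I∈𝒫} P(1_{I₀}σ, I)²·E(w,I)²·w(I) ≤ C·𝓗²·σ(I₀), with an absolute constant C. The same holds with the roles of σ and w interchanged. -/

import Mathlib

open MeasureTheory Set Metric Filter
open scoped ENNReal NNReal

noncomputable section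

namespace TwoWeight

/-! ### Truncated Hilbert transforms -/

/-- The smooth truncation kernel `K_{α,β}` on the positive half-line. -/
def K0 (α β y : ℝ) : ℝ :=
  if y < α then -y / α ^ 2 + 2 / α
  else if y ≤ β then 1 / y
  else if y < 2 * β then -y / β ^ 2 + 2 / β
  else 0

/-- The smooth truncation kernel `K_{α,β}`: odd, vanishing at `0`. -/
def Kab (α β y : ℝ) : ℝ :=
  if 0 < y then K0 α β y else if y < 0 then -K0 α β (-y) else 0

/-- Smoothly truncated Hilbert transform `H_{α,β}(fσ)(x) = ∫ K_{α,β}(y-x) f(y) dσ(y)`. -/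
def Hsm (σ : Measure ℝ) (f : ℝ → ℝ) (α β x : ℝ) : ℝ :=
  ∫ y, Kab α β (y - x) * f y ∂σ

/-- Smoothly truncated Hilbert transform of the measure `1_s σ`. -/
def HsmS (σ : Measure ℝ) (s : Set ℝ) (α β x : ℝ) : ℝ :=
  ∫ y in s, Kab α β (y - x) ∂σ

/-- Hard truncated Hilbert transform `H_{ε,δ}(fσ)(x) = ∫_{ε<|y-x|<δ} f(y)/(y-x) dσ(y)`. -/
def Hhard (σ : Measure ℝ) (f : ℝ → ℝ) (ε δ x : ℝ) : ℝ :=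
  ∫ y in {y : ℝ | ε < |y - x| ∧ |y - x| < δ}, f y / (y - x) ∂σ

/-- Hard truncated Hilbert transform of the measure `1_s σ`. -/
def HhardS (σ : Measure ℝ) (s : Set ℝ) (ε δ x : ℝ) : ℝ :=
  ∫ y in s ∩ {y : ℝ | ε < |y - x| ∧ |y - x| < δ}, 1 / (y - x) ∂σ

/-! ### Poisson averages and extensions -/

/-- Poisson average `P(σ, I)` of a measure relative to a set `s` of "length" `len`. -/
def Pois (σ : Measure ℝ) (s : Set ℝ) (len : ℝ) : ℝ≥0∞ :=
  ∫⁻ x, ENNReal.ofReal (len / (len ^ 2 + infDist x s ^ 2)) ∂σ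

/-- Poisson extension `ℙν(x,t) = ∫ t/(t² + |x-y|²) dν(y)` to the upper half plane. -/
def PoisExt (ν : Measure ℝ) (x t : ℝ) : ℝ≥0∞ :=
  ∫⁻ y, ENNReal.ofReal (t / (t ^ 2 + (x - y) ^ 2)) ∂ν

/-- The Poisson `A₂` condition: `P(σ,I)·P(w,I) ≤ A₂` over all (open) intervals. -/
def A2cond (σ w : Measure ℝ) (A2 : ℝ) : Prop :=
  ∀ a b : ℝ, a < b →
    Pois σ (Ioo a b) (b - a) * Pois w (Ioo a b) (b - a) ≤ ENNReal.ofReal A2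

/-- The pair of weights has no common point masses. -/
def NoCommonMass (σ w : Measure ℝ) : Prop := ∀ x : ℝ, σ {x} = 0 ∨ w {x} = 0

/-- `∫ f² dσ` as an extended real. -/
def sqInt (σ : Measure ℝ) (f : ℝ → ℝ) : ℝ≥0∞ :=
  ∫⁻ x, ENNReal.ofReal (f x ^ 2) ∂σ

/-- Interval testing conditions for the smooth truncations, with constant `T`:
`∫_I |H_{α,β}(1_I σ)|² dw ≤ T² σ(I)` and dually, over all intervals and truncations. -/
def TestingSm (σ w : Measure ℝ) (T : ℝ) : Prop :=
  ∀ a b α β : ℝ, a < b → 0 < α → α < β →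
    (∫⁻ x in Ioo a b, ENNReal.ofReal (HsmS σ (Ioo a b) α β x ^ 2) ∂w)
        ≤ ENNReal.ofReal (T ^ 2) * σ (Ioo a b) ∧
    (∫⁻ x in Ioo a b, ENNReal.ofReal (HsmS w (Ioo a b) α β x ^ 2) ∂σ)
        ≤ ENNReal.ofReal (T ^ 2) * w (Ioo a b)

/-! ### The standard dyadic grid.  A dyadic interval `[2^k m, 2^k (m+1))` is coded by
the pair `(k, m) : ℤ × ℤ`. -/

/-- Length `2^k` of the dyadic interval coded by `(k,m)`. -/
def dlen (I : ℤ × ℤ) : ℝ := (2 : ℝ) ^ I.1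

/-- Left endpoint of a dyadic interval. -/
def dleft (I : ℤ × ℤ) : ℝ := (2 : ℝ) ^ I.1 * I.2

/-- Right endpoint of a dyadic interval. -/
def dright (I : ℤ × ℤ) : ℝ := (2 : ℝ) ^ I.1 * (I.2 + 1)

/-- Center of a dyadic interval. -/
def dmid (I : ℤ × ℤ) : ℝ := dleft I + dlen I / 2

/-- The dyadic interval `[2^k m, 2^k (m+1)) ⊆ ℝ` coded by `(k,m)`. -/
def dset (I : ℤ × ℤ) : Set ℝ := Ico (dleft I) (dright I)

/-- Left child of a dyadic interval. -/
def childL (I : ℤ × ℤ) : ℤ × ℤ := (I.1 - 1, 2 * I.2)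

/-- Right child of a dyadic interval. -/
def childR (I : ℤ × ℤ) : ℤ × ℤ := (I.1 - 1, 2 * I.2 + 1)

/-- The child of `I` containing (the dyadic interval) `F`, defaulting to the left child. -/
def childC (I F : ℤ × ℤ) : ℤ × ℤ :=
  haveI := Classical.propDecidable (dset F ⊆ dset (childL I))
  if dset F ⊆ dset (childL I) then childL I else childR I

/-- `J ⋐ I` : `J ⊆ I` and `2^r |J| ≤ |I|`. -/
def cSub (r : ℕ) (J I : ℤ × ℤ) : Prop := dset J ⊆ dset I ∧ (2 : ℝ) ^ r * dlen J ≤ dlen I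

/-- A dyadic interval `J` is `(ε,r)`-good: for every dyadic `I` with `|I| ≥ 2^(r-1)|J|`,
the distance of `J` to each endpoint of each child of `I` is at least `|J|^ε |I|^(1-ε)`. -/
def IsGood (ε : ℝ) (r : ℕ) (J : ℤ × ℤ) : Prop :=
  ∀ I : ℤ × ℤ, (2 : ℝ) ^ ((r : ℤ) - 1) * dlen J ≤ dlen I →
    ∀ e ∈ ({dleft I, dmid I, dright I} : Set ℝ),
      dlen J ^ ε * dlen I ^ (1 - ε) ≤ infDist e (dset J)

/-! ### Haar functions and projections -/

/-- The `w`-Haar function associated to the dyadic interval `I`. -/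
def haar (w : Measure ℝ) (I : ℤ × ℤ) (x : ℝ) : ℝ :=
  Real.sqrt ((w (dset (childL I))).toReal * (w (dset (childR I))).toReal / (w (dset I)).toReal) *
    (-(dset (childL I)).indicator (fun _ => (1 : ℝ)) x / (w (dset (childL I))).toReal +
      (dset (childR I)).indicator (fun _ => (1 : ℝ)) x / (w (dset (childR I))).toReal)

/-- Haar coefficient `ĝ(I) = ⟨g, h^w_I⟩_{L²(w)}`. -/
def hcoef (w : Measure ℝ) (I : ℤ × ℤ) (g : ℝ → ℝ) : ℝ := ∫ x, g x * haar w I x ∂w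

/-- Haar martingale difference `Δ^w_I g = ĝ(I) h^w_I`. -/
def haarProj (w : Measure ℝ) (I : ℤ × ℤ) (g : ℝ → ℝ) (x : ℝ) : ℝ := hcoef w I g * haar w I x

/-- `σ`-average `E^σ_s f = σ(s)⁻¹ ∫_s f dσ`. -/
def avg (σ : Measure ℝ) (s : Set ℝ) (f : ℝ → ℝ) : ℝ := (∫ x in s, f x ∂σ) / (σ s).toReal

/-- The energy `E(w,I)² = w(I)⁻² ∬_{I×I} ((x-x')/|I|)² dw(x) dw(x')`. -/
def energySq (w : Measure ℝ) (I : ℤ × ℤ) : ℝ≥0∞ :=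
  (w (dset I))⁻¹ ^ 2 *
    ∫⁻ x in dset I, ∫⁻ y in dset I, ENNReal.ofReal (((x - y) / dlen I) ^ 2) ∂w ∂w

/-- `𝓕` is a `σ`-Carleson collection (with constant 2). -/
def Carleson (σ : Measure ℝ) (𝓕 : Set (ℤ × ℤ)) : Prop :=
  ∀ S : ℤ × ℤ, ∑' F : {F // F ∈ 𝓕 ∧ dset F ⊆ dset S}, σ (dset F.1) ≤ 2 * σ (dset S)

/-- `F = π_𝓕 J` : `F` is the minimal member of `𝓕` containing `J`. -/
def IsMinCont (𝓕 : Set (ℤ × ℤ)) (J F : ℤ × ℤ) : Prop :=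
  F ∈ 𝓕 ∧ dset J ⊆ dset F ∧ ∀ F' ∈ 𝓕, dset J ⊆ dset F' → dset F ⊆ dset F'

/-- `F` is the minimal member of `𝓕` strictly containing `J`. -/
def IsMinSCont (𝓕 : Set (ℤ × ℤ)) (J F : ℤ × ℤ) : Prop :=
  F ∈ 𝓕 ∧ dset J ⊂ dset F ∧ ∀ F' ∈ 𝓕, dset J ⊂ dset F' → dset F ⊆ dset F'

/-- `PiIter 𝓕 s J F` : `F = π^s_𝓕 J`, the `s`-fold iterate of the stopping parent of `J`. -/
def PiIter (𝓕 : Set (ℤ × ℤ)) : ℕ → ℤ × ℤ → ℤ × ℤ → Prop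
  | 0, J, F => J = F
  | 1, J, F => IsMinCont 𝓕 J F
  | n + 2, J, F => ∃ F', PiIter 𝓕 (n + 1) J F' ∧ IsMinSCont 𝓕 F' F

/-- The collection `𝒥(F)` of good intervals `J` with `π^s_𝓕 J = F` and `J ⋐ F`. -/
def Jcal (ε : ℝ) (r s : ℕ) (𝓕 : Set (ℤ × ℤ)) (F : ℤ × ℤ) : Set (ℤ × ℤ) :=
  {J | IsGood ε r J ∧ PiIter 𝓕 s J F ∧ cSub r J F}

/-- The maximal intervals `𝒥*(F)` of `𝒥(F)`. -/
def Jstar (ε : ℝ) (r s : ℕ) (𝓕 : Set (ℤ × ℤ)) (F : ℤ × ℤ) : Set (ℤ × ℤ) :=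
  {J ∈ Jcal ε r s 𝓕 F | ∀ J' ∈ Jcal ε r s 𝓕 F, dset J ⊆ dset J' → J' = J}

/-- The projection `P^w_{F,J} φ = Σ_{J' ∈ 𝓙, J' ⊆ J} Δ^w_{J'} φ`. -/
def projIn (w : Measure ℝ) (𝓙 : Set (ℤ × ℤ)) (J : ℤ × ℤ) (φ : ℝ → ℝ) (x : ℝ) : ℝ :=
  ∑' J' : {J' // J' ∈ 𝓙 ∧ dset J' ⊆ dset J}, haarProj w J'.1 φ x

/-- `‖P^w_{F,J} φ‖²_{L²(w)}`. -/
def projNormSq (w : Measure ℝ) (𝓙 : Set (ℤ × ℤ)) (J : ℤ × ℤ) (φ : ℝ → ℝ) : ℝ≥0∞ :=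
  ∫⁻ x, ENNReal.ofReal (projIn w 𝓙 J φ x ^ 2) ∂w

/-- A function is good when (up to null sets) its Haar expansion uses only good intervals. -/
def GoodFn (ε : ℝ) (r : ℕ) (μ : Measure ℝ) (f : ℝ → ℝ) : Prop :=
  f =ᵐ[μ] fun x => ∑' I : {I : ℤ × ℤ // IsGood ε r I}, haarProj μ I.1 f x

end TwoWeight

namespace TwoWeight

lemma div_sq_le_K0_sub {α β u v M : ℝ} (hα : 0 < α) (hu : 0 < u) (huv : u ≤ v) (hv : v ≤ β)
    (hαM : α ≤ M) (hvM : v ≤ M) : (v - u) / M ^ 2 ≤ K0 α β u - K0 α β v := by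
  have hv0 : 0 < v := hu.trans_le huv
  have hinv : ∀ s t : ℝ, 0 < s → s ≤ t → t ≤ M → (t - s) / M ^ 2 ≤ 1 / s - 1 / t := by
    intro s t hs hst htM
    have ht : 0 < t := hs.trans_le hst
    have h : 1 / s - 1 / t = (t - s) / (s * t) := by field_simp
    rw [h]
    exact div_le_div_of_nonneg_left (by linarith) (by positivity) (by nlinarith)
  have hlin : ∀ s t : ℝ, s ≤ t → (t - s) / M ^ 2 ≤ (t - s) / α ^ 2 := by
    intro s t hst
    exact div_le_div_of_nonneg_left (by linarith) (by positivity) (by gcongr)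
  unfold K0
  by_cases hva : v < α
  · rw [if_pos (huv.trans_lt hva), if_pos hva]
    refine (hlin u v huv).trans (le_of_eq ?_)
    ring
  · push Not at hva
    rw [if_neg hva.not_gt, if_pos hv]
    by_cases hua : u < α
    · rw [if_pos hua]
      have h1 := hinv α v hα hva hvM
      have h2 := hlin u α hua.le
      have h3 : -u / α ^ 2 + 2 / α = (α - u) / α ^ 2 + 1 / α := by field_simp; ring
      have h4 : (v - u) / M ^ 2 = (v - α) / M ^ 2 + (α - u) / M ^ 2 := by ring
      rw [h3, h4]
      linarith
    · rw [if_neg hua, if_pos (huv.trans hv)]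
      exact hinv u v hu huv hvM

lemma abs_K0_le {α β y : ℝ} (hα : 0 < α) (hαβ : α < β) (hy : 0 < y) :
    |K0 α β y| ≤ 2 / α := by
  have hlin : ∀ γ : ℝ, 0 < γ → y < 2 * γ → |-y / γ ^ 2 + 2 / γ| ≤ 2 / γ := by
    intro γ hγ hyγ
    have h1 : 0 ≤ y / γ ^ 2 := by positivity
    have h2 : y / γ ^ 2 ≤ 2 / γ := by
      rw [div_le_div_iff₀ (by positivity) hγ]
      nlinarith
    rw [neg_div, abs_le]
    constructor <;> linarith
  unfold K0
  split_ifs with h1 h2 h3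
  · exact hlin α hα (by linarith)
  · rw [abs_of_nonneg (by positivity)]
    exact div_le_div₀ (by norm_num) (by norm_num) hα (not_lt.1 h1)
  · exact (hlin β (hα.trans hαβ) h3).trans (by gcongr)
  · rw [abs_zero]
    positivity

lemma abs_Kab_le {α β : ℝ} (hα : 0 < α) (hαβ : α < β) (y : ℝ) : |Kab α β y| ≤ 2 / α := by
  unfold Kab
  split_ifs with h1 h2
  · exact abs_K0_le hα hαβ h1
  · rw [abs_neg]
    exact abs_K0_le hα hαβ (by linarith)
  · rw [abs_zero]
    positivity

lemma measurable_K0 (α β : ℝ) : Measurable (K0 α β) := by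
  unfold K0
  refine Measurable.ite (measurableSet_lt measurable_id measurable_const) (by fun_prop) ?_
  refine Measurable.ite (measurableSet_le measurable_id measurable_const) (by fun_prop) ?_
  exact Measurable.ite (measurableSet_lt measurable_id measurable_const) (by fun_prop)
    measurable_const

lemma measurable_Kab (α β : ℝ) : Measurable (Kab α β) := by
  have h := measurable_K0 α β
  unfold Kab
  refine Measurable.ite (measurableSet_lt measurable_const measurable_id) h ?_
  exact Measurable.ite (measurableSet_lt measurable_id measurable_const)
    (h.comp measurable_neg).neg measurable_const

lemma integrable_Kab (μ : Measure ℝ) [IsFiniteMeasure μ] {α β : ℝ} (hα : 0 < α) (hαβ : α < β)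
    (x : ℝ) : Integrable (fun y => Kab α β (y - x)) μ := by
  refine Integrable.of_bound (C := 2 / α)
    ((measurable_Kab α β).comp (measurable_id.sub_const x)).aestronglyMeasurable ?_
  exact ae_of_all _ fun y => abs_Kab_le hα hαβ _

lemma measurable_HsmS (σ : Measure ℝ) [SFinite σ] (s : Set ℝ) (α β : ℝ) :
    Measurable (HsmS σ s α β) := by
  unfold HsmS
  refine (StronglyMeasurable.integral_prod_right
    (f := fun x y => Kab α β (y - x)) (ν := σ.restrict s) ?_).measurable
  exact ((measurable_Kab α β).comp (measurable_snd.sub measurable_fst)).stronglyMeasurable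

/-- Monotonicity of the truncated Hilbert kernel on an interval, seen from outside. -/
lemma div_le_Kab_sub {α β a b x x' y : ℝ} (hα : 0 < α) (hαI : α ≤ b - a)
    (hx : x ∈ Ico a b) (hx' : x' ∈ Ico a b) (hxx' : x ≤ x') (hy : y ∉ Ico a b)
    (hyx : |y - x| ≤ β) (hyx' : |y - x'| ≤ β) :
    (x' - x) / (b - a) / 2 * ((b - a) / ((b - a) ^ 2 + infDist y (Ico a b) ^ 2)) ≤
      Kab α β (y - x') - Kab α β (y - x) := by
  have hlen : 0 < b - a := hα.trans_le hαI
  set d := infDist y (Ico a b) with hd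
  have hd0 : 0 ≤ d := infDist_nonneg
  have hne : (Ico a b).Nonempty := ⟨x, hx⟩
  have hstep : (x' - x) / (b - a) / 2 * ((b - a) / ((b - a) ^ 2 + d ^ 2)) ≤
      (x' - x) / (b - a + d) ^ 2 := by
    have h : (x' - x) / (b - a) / 2 * ((b - a) / ((b - a) ^ 2 + d ^ 2)) =
        (x' - x) / (2 * ((b - a) ^ 2 + d ^ 2)) := by
      have : b - a ≠ 0 := hlen.ne'
      field_simp
    rw [h]
    exact div_le_div_of_nonneg_left (by linarith) (by positivity)
      (by nlinarith [sq_nonneg (b - a - d)])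
  refine hstep.trans ?_
  obtain ⟨hx1, hx2⟩ := hx
  obtain ⟨hx'1, hx'2⟩ := hx'
  rw [abs_le] at hyx hyx'
  by_cases hya : y < a
  · have hda : a - y ≤ d := by
      rw [hd, le_infDist hne]
      intro z hz
      rw [dist_comm, Real.dist_eq]
      exact (by linarith [hz.1] : a - y ≤ z - y).trans (le_abs_self _)
    have h := div_sq_le_K0_sub (β := β) (u := x - y) (v := x' - y) (M := b - a + d) hα
      (by linarith) (by linarith) (by linarith) (by linarith) (by linarith)
    unfold Kab
    rw [if_neg (by linarith), if_pos (by linarith), if_neg (by linarith), if_pos (by linarith),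
      neg_sub, neg_sub]
    have h2 : x' - y - (x - y) = x' - x := by ring
    rw [h2] at h
    linarith
  · have hyb : b ≤ y := by
      by_contra hc
      exact hy ⟨not_lt.1 hya, not_le.1 hc⟩
    have hdb : y - b ≤ d := by
      rw [hd, le_infDist hne]
      intro z hz
      rw [Real.dist_eq]
      exact (by linarith [hz.2] : y - b ≤ y - z).trans (le_abs_self _)
    have h := div_sq_le_K0_sub (β := β) (u := y - x') (v := y - x) (M := b - a + d) hα
      (by linarith) (by linarith) (by linarith) (by linarith) (by linarith)
    unfold Kab
    rw [if_pos (by linarith), if_pos (by linarith)]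
    have h2 : y - x - (y - x') = x' - x := by ring
    rwa [h2] at h

lemma integrable_poisson (μ : Measure ℝ) [IsFiniteMeasure μ] {l : ℝ} (hl : 0 < l) (s : Set ℝ) :
    Integrable (fun y => l / (l ^ 2 + infDist y s ^ 2)) μ := by
  have hm : Measurable fun y => l / (l ^ 2 + infDist y s ^ 2) := by
    have := (continuous_infDist_pt s).measurable
    fun_prop
  refine Integrable.of_bound (C := l / l ^ 2) hm.aestronglyMeasurable (ae_of_all _ fun y => ?_)
  rw [Real.norm_eq_abs, abs_of_nonneg (by positivity)]
  exact div_le_div_of_nonneg_left hl.le (by positivity) (by nlinarith [sq_nonneg (infDist y s)])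

lemma Pois_eq_ofReal (μ : Measure ℝ) [IsFiniteMeasure μ] {l : ℝ} (hl : 0 < l) (s : Set ℝ) :
    Pois μ s l = ENNReal.ofReal (∫ y, l / (l ^ 2 + infDist y s ^ 2) ∂μ) :=
  (ofReal_integral_eq_lintegral_ofReal (integrable_poisson μ hl s)
    (ae_of_all _ fun y => by dsimp only [Pi.zero_apply]; positivity)).symm

/-- The Poisson average of a measure living off `[a,b)` is controlled by the oscillation of its
truncated Hilbert transform on `[a,b)`. -/
lemma mul_poisson_le_HsmS_sub (σ : Measure ℝ) [IsLocallyFiniteMeasure σ] {α β a b c d x x' : ℝ}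
    (hα : 0 < α) (hαI : α ≤ b - a) (hαβ : α < β) (hβ : d - c ≤ β)
    (hsub : Ico a b ⊆ Ico c d) (hx : x ∈ Ico a b) (hx' : x' ∈ Ico a b) (hxx' : x ≤ x') :
    (x' - x) / (b - a) / 2 *
        ∫ y in Ico c d \ Ico a b, (b - a) / ((b - a) ^ 2 + infDist y (Ico a b) ^ 2) ∂σ ≤
      (HsmS σ (Ico c d) α β x' - HsmS σ (Ico a b) α β x') -
        (HsmS σ (Ico c d) α β x - HsmS σ (Ico a b) α β x) := by
  have hfin : ∀ p q : ℝ, IsFiniteMeasure (σ.restrict (Ico p q)) := fun p q =>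
    ⟨by simpa using (measure_Ico_lt_top (μ := σ))⟩
  have := hfin c d
  have hfd : IsFiniteMeasure (σ.restrict (Ico c d \ Ico a b)) :=
    isFiniteMeasure_of_le _ (Measure.restrict_mono sdiff_subset le_rfl)
  have hdiff : ∀ z, HsmS σ (Ico c d) α β z - HsmS σ (Ico a b) α β z =
      ∫ y in Ico c d \ Ico a b, Kab α β (y - z) ∂σ := fun z =>
    (setIntegral_sdiff measurableSet_Ico (integrable_Kab _ hα hαβ z) hsub).symm
  rw [hdiff, hdiff, ← integral_const_mul,
    ← integral_sub (integrable_Kab _ hα hαβ _) (integrable_Kab _ hα hαβ _)]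
  refine setIntegral_mono_on ((integrable_poisson _ (hα.trans_le hαI) _).const_mul _)
    ((integrable_Kab _ hα hαβ _).sub (integrable_Kab _ hα hαβ _))
    (measurableSet_Ico.diff measurableSet_Ico) ?_
  rintro y ⟨hy, hyI⟩
  have hdist : ∀ z ∈ Ico a b, |y - z| ≤ β := fun z hz => by
    obtain ⟨h1, h2⟩ := hsub hz
    rw [abs_le]
    constructor <;> linarith [hy.1, hy.2]
  exact div_le_Kab_sub hα hαI hx hx' hxx' hyI (hdist x hx) (hdist x' hx')

lemma lintegral_lintegral_add (μ : Measure ℝ) [IsFiniteMeasure μ] (g : ℝ → ℝ≥0∞) :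
    ∫⁻ x, ∫⁻ y, (g x + g y) ∂μ ∂μ = 2 * μ univ * ∫⁻ x, g x ∂μ := by
  simp_rw [lintegral_add_left measurable_const, lintegral_const]
  rw [lintegral_add_right _ measurable_const, lintegral_mul_const' _ _ (measure_ne_top μ univ),
    lintegral_const]
  ring

lemma Pois_sq_mul_lintegral_le (σ w : Measure ℝ) [IsLocallyFiniteMeasure σ]
    [IsLocallyFiniteMeasure w] {α β a b c d : ℝ} (hα : 0 < α) (hαI : α ≤ b - a) (hαβ : α < β)
    (hβ : d - c ≤ β) (hsub : Ico a b ⊆ Ico c d) :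
    Pois (σ.restrict (Ico c d \ Ico a b)) (Ico a b) (b - a) ^ 2 *
        ∫⁻ x in Ico a b, ∫⁻ y in Ico a b, ENNReal.ofReal (((x - y) / (b - a)) ^ 2) ∂w ∂w ≤
      32 * w (Ico a b) * (∫⁻ x in Ico a b, ENNReal.ofReal (HsmS σ (Ico c d) α β x ^ 2) ∂w +
        ∫⁻ x in Ico a b, ENNReal.ofReal (HsmS σ (Ico a b) α β x ^ 2) ∂w) := by
  have hfd : IsFiniteMeasure (σ.restrict (Ico c d \ Ico a b)) :=
    ⟨by simpa using (measure_mono sdiff_subset).trans_lt (measure_Ico_lt_top (μ := σ))⟩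
  have hfw : IsFiniteMeasure (w.restrict (Ico a b)) :=
    ⟨by simpa using (measure_Ico_lt_top (μ := w))⟩
  have hl : 0 < b - a := hα.trans_le hαI
  rw [Pois_eq_ofReal _ hl]
  set p := ∫ y in Ico c d \ Ico a b, (b - a) / ((b - a) ^ 2 + infDist y (Ico a b) ^ 2) ∂σ with hp
  have hp0 : 0 ≤ p := integral_nonneg fun y => by dsimp only [Pi.zero_apply]; positivity
  set f : ℝ → ℝ := fun x => HsmS σ (Ico c d) α β x ^ 2 + HsmS σ (Ico a b) α β x ^ 2 with hf
  have hf0 : ∀ x, 0 ≤ f x := fun x => by positivity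
  have hord : ∀ x ∈ Ico a b, ∀ y ∈ Ico a b, x ≤ y →
      p ^ 2 * ((x - y) / (b - a)) ^ 2 ≤ 16 * (f x + f y) := by
    intro x hx y hy hxy
    have h := mul_poisson_le_HsmS_sub σ hα hαI hαβ hβ hsub hx hy hxy
    rw [← hp] at h
    have h0 : 0 ≤ (y - x) / (b - a) / 2 * p :=
      mul_nonneg (div_nonneg (div_nonneg (by linarith) hl.le) (by norm_num)) hp0
    have h2 := pow_le_pow_left₀ h0 h 2
    have h3 : p ^ 2 * ((x - y) / (b - a)) ^ 2 = 4 * ((y - x) / (b - a) / 2 * p) ^ 2 := by ring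
    have h4 : ∀ A B C D : ℝ, ((A - B) - (C - D)) ^ 2 ≤ 4 * ((C ^ 2 + D ^ 2) + (A ^ 2 + B ^ 2)) := by
      intro A B C D
      nlinarith [sq_nonneg (A + B), sq_nonneg (C + D), sq_nonneg ((A - B) + (C - D))]
    rw [h3]
    have h5 := h2.trans (h4 _ _ _ _)
    simp only [hf]
    linarith
  have hpt : ∀ x ∈ Ico a b, ∀ y ∈ Ico a b,
      ENNReal.ofReal p ^ 2 * ENNReal.ofReal (((x - y) / (b - a)) ^ 2) ≤
        16 * (ENNReal.ofReal (f x) + ENNReal.ofReal (f y)) := by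
    intro x hx y hy
    have h16 : (16 : ℝ≥0∞) = ENNReal.ofReal 16 := by norm_num
    rw [← ENNReal.ofReal_pow hp0, ← ENNReal.ofReal_mul (by positivity), h16,
      ← ENNReal.ofReal_add (hf0 x) (hf0 y), ← ENNReal.ofReal_mul (by norm_num)]
    refine ENNReal.ofReal_le_ofReal ?_
    rcases le_total x y with hxy | hxy
    · exact hord x hx y hy hxy
    · have h := hord y hy x hx hxy
      rw [add_comm (f y)] at h
      have h2 : p ^ 2 * ((x - y) / (b - a)) ^ 2 = p ^ 2 * ((y - x) / (b - a)) ^ 2 := by ring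
      rwa [h2]
  have hpfin : ENNReal.ofReal p ^ 2 ≠ ⊤ := by finiteness
  have hsum : ∫⁻ x in Ico a b, ENNReal.ofReal (f x) ∂w =
      ∫⁻ x in Ico a b, ENNReal.ofReal (HsmS σ (Ico c d) α β x ^ 2) ∂w +
        ∫⁻ x in Ico a b, ENNReal.ofReal (HsmS σ (Ico a b) α β x ^ 2) ∂w := by
    rw [← lintegral_add_left ((measurable_HsmS σ _ α β).pow_const 2).ennreal_ofReal]
    exact lintegral_congr fun x => ENNReal.ofReal_add (sq_nonneg _) (sq_nonneg _)
  rw [← hsum]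
  simp_rw [← lintegral_const_mul' _ _ hpfin]
  calc _ ≤ ∫⁻ x in Ico a b, ∫⁻ y in Ico a b,
          16 * (ENNReal.ofReal (f x) + ENNReal.ofReal (f y)) ∂w ∂w :=
        setLIntegral_mono' measurableSet_Ico fun x hx =>
          setLIntegral_mono' measurableSet_Ico fun y hy => hpt x hx y hy
    _ = 16 * ∫⁻ x in Ico a b, ∫⁻ y in Ico a b,
          (ENNReal.ofReal (f x) + ENNReal.ofReal (f y)) ∂w ∂w := by
        simp_rw [lintegral_const_mul' (16 : ℝ≥0∞) _ (by finiteness)]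
    _ = _ := by
        rw [lintegral_lintegral_add, Measure.restrict_apply_univ]
        ring

lemma Pois_restrict_self (σ : Measure ℝ) {l : ℝ} (hl : 0 < l) {s : Set ℝ}
    (hs : MeasurableSet s) : Pois (σ.restrict s) s l = ENNReal.ofReal (1 / l) * σ s := by
  rw [← setLIntegral_const]
  refine setLIntegral_congr_fun hs fun x hx => ?_
  simp only [infDist_zero_of_mem hx]
  congr 1
  field_simp
  ring

lemma Pois_restrict_le (σ : Measure ℝ) (s t : Set ℝ) (l : ℝ) :
    Pois (σ.restrict t) s l ≤ Pois σ s l :=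
  lintegral_mono' Measure.restrict_le_self le_rfl

lemma lintegral_sq_div_le (w : Measure ℝ) {a b : ℝ} (hab : a < b) :
    ∫⁻ x in Ico a b, ∫⁻ y in Ico a b, ENNReal.ofReal (((x - y) / (b - a)) ^ 2) ∂w ∂w ≤
      w (Ico a b) ^ 2 := by
  have hl : 0 < b - a := sub_pos.2 hab
  calc _ ≤ ∫⁻ x in Ico a b, ∫⁻ y in Ico a b, 1 ∂w ∂w := by
        refine setLIntegral_mono' measurableSet_Ico fun x hx =>
          setLIntegral_mono' measurableSet_Ico fun y hy => ?_
        rw [ENNReal.ofReal_le_one, sq_le_one_iff_abs_le_one, abs_div, abs_of_pos hl,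
          div_le_one hl, abs_le]
        constructor <;> linarith [hx.1, hx.2, hy.1, hy.2]
    _ = _ := by simp [sq]

lemma dlen_pos (I : ℤ × ℤ) : 0 < dlen I := by
  unfold dlen
  positivity

lemma dright_sub_dleft (I : ℤ × ℤ) : dright I - dleft I = dlen I := by
  unfold dright dleft dlen
  ring

lemma dset_ae_eq_Ioo {σ : Measure ℝ} {I : ℤ × ℤ} (h : σ {dleft I} = 0) :
    dset I =ᵐ[σ] Ioo (dleft I) (dright I) :=
  (Ioo_ae_eq_Ico' h).symm

lemma sq_add_le_two_mul (x y : ℝ≥0∞) : (x + y) ^ 2 ≤ 2 * (x ^ 2 + y ^ 2) := by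
  have h := ENNReal.rpow_add_le_mul_rpow_add_rpow x y (one_le_two : (1 : ℝ) ≤ 2)
  norm_num at h
  exact h

lemma lintegral_HsmS_sq_le {σ w : Measure ℝ} {T α β : ℝ} (hα : 0 < α) (hαβ : α < β)
    {I : ℤ × ℤ} (hσ : σ {dleft I} = 0) (hw : w {dleft I} = 0) (hT : TestingSm σ w T) :
    ∫⁻ x in dset I, ENNReal.ofReal (HsmS σ (dset I) α β x ^ 2) ∂w ≤
      ENNReal.ofReal (T ^ 2) * σ (dset I) := by
  have hlt : dleft I < dright I := by linarith [dlen_pos I, dright_sub_dleft I]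
  have h := (hT _ _ α β hlt hα hαβ).1
  unfold HsmS at h ⊢
  simp_rw [setIntegral_congr_set (dset_ae_eq_Ioo hσ)]
  rwa [setLIntegral_congr (dset_ae_eq_Ioo hw), measure_congr (dset_ae_eq_Ioo hσ)]

lemma density_mul_density_le {σ w : Measure ℝ} {A2 : ℝ} (hA2 : A2cond σ w A2) {I : ℤ × ℤ}
    (hσ : σ {dleft I} = 0) (hw : w {dleft I} = 0) :
    (ENNReal.ofReal (1 / dlen I) * σ (dset I)) * (ENNReal.ofReal (1 / dlen I) * w (dset I)) ≤
      ENNReal.ofReal A2 := by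
  have hlt : dleft I < dright I := by linarith [dlen_pos I, dright_sub_dleft I]
  have h := hA2 _ _ hlt
  rw [dright_sub_dleft] at h
  rw [measure_congr (dset_ae_eq_Ioo hσ), measure_congr (dset_ae_eq_Ioo hw),
    ← Pois_restrict_self σ (dlen_pos I) measurableSet_Ioo,
    ← Pois_restrict_self w (dlen_pos I) measurableSet_Ioo]
  exact (mul_le_mul' (Pois_restrict_le _ _ _ _) (Pois_restrict_le _ _ _ _)).trans h

/-- The energy term of a single interval of the partition. -/
lemma Pois_sq_mul_energySq_mul_le (σ w : Measure ℝ) [IsLocallyFiniteMeasure σ]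
    [IsLocallyFiniteMeasure w] {A2 T α β : ℝ} (hA0 : 0 ≤ A2) (hA2 : A2cond σ w A2)
    (hT : TestingSm σ w T)
    {I I₀ : ℤ × ℤ} (hσ : σ {dleft I} = 0) (hw : w {dleft I} = 0) (hα : 0 < α)
    (hαI : α ≤ dlen I) (hαβ : α < β) (hβ : dlen I₀ ≤ β) (hsub : dset I ⊆ dset I₀) :
    Pois (σ.restrict (dset I₀)) (dset I) (dlen I) ^ 2 * energySq w I * w (dset I) ≤
      ENNReal.ofReal (2 * A2 + 64 * T ^ 2) * σ (dset I) +
        64 * ∫⁻ x in dset I, ENNReal.ofReal (HsmS σ (dset I₀) α β x ^ 2) ∂w := by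
  rcases eq_or_ne (w (dset I)) 0 with hw0 | hw0
  · simp [hw0]
  have hwt : w (dset I) ≠ ⊤ := (measure_Ico_lt_top (μ := w)).ne
  have hlt : dleft I < dright I := by linarith [dlen_pos I, dright_sub_dleft I]
  have hmI : MeasurableSet (dset I) := measurableSet_Ico
  have hsplit : Pois (σ.restrict (dset I₀)) (dset I) (dlen I) =
      Pois (σ.restrict (dset I)) (dset I) (dlen I) +
        Pois (σ.restrict (dset I₀ \ dset I)) (dset I) (dlen I) := by
    unfold Pois
    rw [← lintegral_inter_add_sdiff _ (dset I₀) hmI, inter_eq_right.2 hsub]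
  have hosc := Pois_sq_mul_lintegral_le σ w (a := dleft I) (b := dright I) (c := dleft I₀)
    (d := dright I₀) hα (by rwa [dright_sub_dleft]) hαβ (by rwa [dright_sub_dleft]) hsub
  have hD := lintegral_sq_div_le w hlt
  rw [dright_sub_dleft] at hosc hD
  have htest := lintegral_HsmS_sq_le (β := β) hα hαβ hσ hw hT
  have hA := density_mul_density_le hA2 hσ hw
  rw [hsplit, Pois_restrict_self σ (dlen_pos I) hmI]
  unfold energySq
  set W := w (dset I)
  set S := σ (dset I)
  set B := Pois (σ.restrict (dset I₀ \ dset I)) (dset I) (dlen I)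
  set D := ∫⁻ x in dset I, ∫⁻ y in dset I, ENNReal.ofReal (((x - y) / dlen I) ^ 2) ∂w ∂w
  set G₀ := ∫⁻ x in dset I, ENNReal.ofReal (HsmS σ (dset I₀) α β x ^ 2) ∂w
  set G := ∫⁻ x in dset I, ENNReal.ofReal (HsmS σ (dset I) α β x ^ 2) ∂w
  set r := ENNReal.ofReal (1 / dlen I)
  replace hosc : B ^ 2 * D ≤ 32 * W * (G₀ + G) := hosc
  replace hD : D ≤ W ^ 2 := hD
  have hWW : W⁻¹ * W = 1 := ENNReal.inv_mul_cancel hw0 hwt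
  have hinner : (r * S) ^ 2 * (W⁻¹ ^ 2 * D) * W ≤ ENNReal.ofReal A2 * S := by
    calc (r * S) ^ 2 * (W⁻¹ ^ 2 * D) * W ≤ (r * S) ^ 2 * (W⁻¹ ^ 2 * W ^ 2) * W := by gcongr
      _ = (r * S) * (r * W) * S * (W⁻¹ * W) ^ 2 := by ring
      _ = (r * S) * (r * W) * S := by rw [hWW]; ring
      _ ≤ _ := by gcongr
  have houter : B ^ 2 * (W⁻¹ ^ 2 * D) * W ≤ 32 * (G₀ + ENNReal.ofReal (T ^ 2) * S) := by
    calc B ^ 2 * (W⁻¹ ^ 2 * D) * W = (W⁻¹ ^ 2 * W) * (B ^ 2 * D) := by ring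
      _ ≤ (W⁻¹ ^ 2 * W) * (32 * W * (G₀ + G)) := by gcongr
      _ = (W⁻¹ * W) ^ 2 * (32 * (G₀ + G)) := by ring
      _ = 32 * (G₀ + G) := by rw [hWW]; ring
      _ ≤ _ := by gcongr
  have hcoef : ENNReal.ofReal (2 * A2 + 64 * T ^ 2) =
      2 * ENNReal.ofReal A2 + 64 * ENNReal.ofReal (T ^ 2) := by
    rw [ENNReal.ofReal_add (by positivity) (by positivity), ENNReal.ofReal_mul (by norm_num),
      ENNReal.ofReal_mul (by norm_num)]
    norm_num
  calc (r * S + B) ^ 2 * (W⁻¹ ^ 2 * D) * W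
      ≤ (2 * ((r * S) ^ 2 + B ^ 2)) * (W⁻¹ ^ 2 * D) * W := by
        gcongr
        exact sq_add_le_two_mul _ _
    _ = 2 * ((r * S) ^ 2 * (W⁻¹ ^ 2 * D) * W) + 2 * (B ^ 2 * (W⁻¹ ^ 2 * D) * W) := by ring
    _ ≤ 2 * (ENNReal.ofReal A2 * S) + 2 * (32 * (G₀ + ENNReal.ofReal (T ^ 2) * S)) := by gcongr
    _ = _ := by
        rw [hcoef]
        ring

lemma energy_inequality (σ w : Measure ℝ) [IsLocallyFiniteMeasure σ]
    [IsLocallyFiniteMeasure w] {A2 T : ℝ} (hA0 : 0 ≤ A2) (hT0 : 0 ≤ T)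
    (hmass : ∀ I : ℤ × ℤ, σ {dleft I} = 0 ∧ w {dleft I} = 0)
    (hA2 : A2cond σ w A2) (hT : TestingSm σ w T) (I₀ : ℤ × ℤ) (Pcoll : Set (ℤ × ℤ))
    (hsub : ∀ I ∈ Pcoll, dset I ⊆ dset I₀) (hdisj : Pcoll.PairwiseDisjoint dset) :
    ∑' I : Pcoll, Pois (σ.restrict (dset I₀)) (dset I.1) (dlen I.1) ^ 2 *
        energySq w I.1 * w (dset I.1) ≤
      ENNReal.ofReal (128 * (Real.sqrt A2 + T) ^ 2) * σ (dset I₀) := by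
  rw [ENNReal.tsum_eq_iSup_sum]
  refine iSup_le fun s => ?_
  have hev : ∀ᶠ α : ℝ in nhdsWithin 0 (Ioi 0), 0 < α ∧ α < dlen I₀ ∧ ∀ I ∈ s, α < dlen I.1 := by
    have hlt : ∀ l : ℝ, 0 < l → ∀ᶠ α : ℝ in nhdsWithin 0 (Ioi 0), α < l := fun l hl =>
      eventually_nhdsWithin_of_eventually_nhds (eventually_lt_nhds hl)
    exact eventually_mem_nhdsWithin.and
      ((hlt _ (dlen_pos _)).and ((Finset.eventually_all s).2 fun I _ => hlt _ (dlen_pos _)))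
  obtain ⟨α, hα, hαβ, hαs⟩ := hev.exists
  have hpd : (s : Set Pcoll).PairwiseDisjoint fun I => dset I.1 := fun I _ J _ hIJ =>
    hdisj I.2 J.2 (Subtype.coe_injective.ne hIJ)
  have hunion : (⋃ I ∈ s, dset I.1) ⊆ dset I₀ := iUnion₂_subset fun I _ => hsub _ I.2
  have hσs : ∑ I ∈ s, σ (dset I.1) ≤ σ (dset I₀) := by
    rw [← measure_biUnion_finset hpd fun _ _ => measurableSet_Ico]
    exact measure_mono hunion
  have hws : ∑ I ∈ s, ∫⁻ x in dset I.1,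
      ENNReal.ofReal (HsmS σ (dset I₀) α (dlen I₀) x ^ 2) ∂w ≤
        ENNReal.ofReal (T ^ 2) * σ (dset I₀) := by
    rw [← lintegral_biUnion_finset hpd fun _ _ => measurableSet_Ico]
    exact (lintegral_mono_set hunion).trans
      (lintegral_HsmS_sq_le hα hαβ (hmass I₀).1 (hmass I₀).2 hT)
  calc _ ≤ ∑ I ∈ s, (ENNReal.ofReal (2 * A2 + 64 * T ^ 2) * σ (dset I.1) +
        64 * ∫⁻ x in dset I.1, ENNReal.ofReal (HsmS σ (dset I₀) α (dlen I₀) x ^ 2) ∂w) :=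
        Finset.sum_le_sum fun I hI => Pois_sq_mul_energySq_mul_le σ w hA0 hA2 hT
          (hmass I.1).1 (hmass I.1).2 hα (hαs I hI).le hαβ le_rfl (hsub _ I.2)
    _ ≤ ENNReal.ofReal (2 * A2 + 64 * T ^ 2) * σ (dset I₀) +
        64 * (ENNReal.ofReal (T ^ 2) * σ (dset I₀)) := by
        rw [Finset.sum_add_distrib, ← Finset.mul_sum, ← Finset.mul_sum]
        gcongr
    _ = ENNReal.ofReal (2 * A2 + 128 * T ^ 2) * σ (dset I₀) := by
        have h64 : (64 : ℝ≥0∞) = ENNReal.ofReal 64 := by norm_num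
        rw [h64, ← mul_assoc, ← ENNReal.ofReal_mul (by norm_num), ← add_mul,
          ← ENNReal.ofReal_add (by positivity) (by positivity)]
        ring_nf
    _ ≤ _ := by
        gcongr
        nlinarith [Real.sq_sqrt hA0, mul_nonneg (Real.sqrt_nonneg A2) hT0]

/-- Proposition 4.3, the energy inequality `𝓔 ≲ 𝓗`.  Under the Poisson
`A₂` condition and the interval testing conditions, for every dyadic interval `I₀` and every
partition `Pcoll` of `I₀` into dyadic intervals,
`Σ_{I∈Pcoll} P(1_{I₀}σ, I)² E(w,I)² w(I) ≤ C 𝓗² σ(I₀)`, where `𝓗 = 𝒜₂^{1/2} + 𝒯`;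
and symmetrically with `σ` and `w` interchanged. -/
theorem statement6 :
    ∃ C : ℝ, 0 < C ∧
      ∀ (σ w : Measure ℝ) (A2 T : ℝ),
        IsLocallyFiniteMeasure σ → IsLocallyFiniteMeasure w →
        NoCommonMass σ w →
        (∀ I : ℤ × ℤ, σ {dleft I} = 0 ∧ w {dleft I} = 0) →
        0 ≤ A2 → 0 ≤ T → A2cond σ w A2 → TestingSm σ w T →
        ∀ (I₀ : ℤ × ℤ) (Pcoll : Set (ℤ × ℤ)),
          (∀ I ∈ Pcoll, dset I ⊆ dset I₀) →
          Pcoll.PairwiseDisjoint dset →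
          (⋃ I ∈ Pcoll, dset I) = dset I₀ →
          (∑' I : Pcoll, Pois (σ.restrict (dset I₀)) (dset I.1) (dlen I.1) ^ 2 *
              energySq w I.1 * w (dset I.1))
            ≤ ENNReal.ofReal (C * (Real.sqrt A2 + T) ^ 2) * σ (dset I₀) ∧
          (∑' I : Pcoll, Pois (w.restrict (dset I₀)) (dset I.1) (dlen I.1) ^ 2 *
              energySq σ I.1 * σ (dset I.1))
            ≤ ENNReal.ofReal (C * (Real.sqrt A2 + T) ^ 2) * w (dset I₀) := by
  refine ⟨128, by norm_num, ?_⟩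
  intro σ w A2 T hσ hw _ hmass hA0 hT0 hA2 hT I₀ Pcoll hsub hdisj _
  refine ⟨energy_inequality σ w hA0 hT0 hmass hA2 hT I₀ Pcoll hsub hdisj,
    energy_inequality w σ hA0 hT0 (fun I => (hmass I).symm) ?_ ?_ I₀ Pcoll hsub hdisj⟩
  · intro a b hab
    rw [mul_comm]
    exact hA2 a b hab
  · exact fun a b α β hab hα hαβ => (hT a b α β hab hα hαβ).symm

end TwoWeight
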